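/- If the cost function c satisfies Assumptions (A) and (C), then it satisfies Assumption (Approx); more precisely, for any μ ∈ P(X), ν ∈ P(Y) and any π ∈ Π(Supp(μ),ν), there exists a sequence πₙ ∈ Π(≪μ,ν) converging weakly to π such that I_c^μ[πₙ] → bar I_c^μ[π]. -/

import Mathlib

open MeasureTheory ProbabilityTheory Topology Filter Set Metric
open scoped NNReal ENNReal

noncomputable section

namespace UWOT

/-- The nonnegative part of an extended real, as an extended nonnegative real. -/
def epos (x : EReal) : ℝ≥0∞ := if x = ⊤ then ⊤ else ENNReal.ofReal x.toReal

/-- Integral of an `EReal`-valued function: positive part minus negative part. -/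
def eintegral {α : Type*} [MeasurableSpace α] (μ : Measure α) (g : α → EReal) : EReal :=
  ((∫⁻ x, epos (g x) ∂μ : ℝ≥0∞) : EReal) - ((∫⁻ x, epos (-(g x)) ∂μ : ℝ≥0∞) : EReal)

/-- Integral of a real-valued function, with value `+∞` when the positive part is not
integrable.  This is the integral "understood in `ℝ ∪ {+∞}`". -/
def eintegralR {α : Type*} [MeasurableSpace α] (μ : Measure α) (f : α → ℝ) : EReal :=
  eintegral μ fun x => (f x : EReal)

variable {X Y : Type*}
  [TopologicalSpace X] [PolishSpace X] [MeasurableSpace X] [BorelSpace X]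
  [TopologicalSpace Y] [PolishSpace Y] [MeasurableSpace Y] [BorelSpace Y]

/-- A nonnegative kernel from `X` to `Y` : a measurable family of finite nonnegative
measures on `Y`. -/
def IsKernel (q : X → FiniteMeasure Y) : Prop :=
  Measurable fun x => (q x : Measure Y)

/-- `μ q = ν` : the kernel `q` transports `μ` onto `ν`. -/
def Transports (μ : Measure X) (q : X → FiniteMeasure Y) (ν : Measure Y) : Prop :=
  μ.bind (fun x => (q x : Measure Y)) = ν

/-- The transport cost `I_c(μ,ν)`, an infimum in `ℝ ∪ {+∞}` (it equals `⊤` when no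
admissible kernel exists). -/
def transportCost (c : X → FiniteMeasure Y → ℝ) (μ : Measure X) (ν : Measure Y) : EReal :=
  sInf {r : EReal | ∃ q : X → FiniteMeasure Y,
    IsKernel q ∧ Transports μ q ν ∧ r = eintegralR μ fun x => c x (q x)}

/-- Standing assumptions on the cost function: convexity in the second variable, joint
lower semicontinuity, and the lower bound (LB). -/
structure IsCost (c : X → FiniteMeasure Y → ℝ) : Prop where
  convex : ∀ (x : X) (m₀ m₁ : FiniteMeasure Y) (t : ℝ≥0), t ≤ 1 →
    c x ((1 - t) • m₀ + t • m₁) ≤ (1 - (t : ℝ)) * c x m₀ + (t : ℝ) * c x m₁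
  lsc : LowerSemicontinuous fun p : X × FiniteMeasure Y => c p.1 p.2
  lb : ∃ r₀ r₁ : ℝ, ∀ (x : X) (m : FiniteMeasure Y), r₀ + r₁ * (m.mass : ℝ) ≤ c x m

/-- The topological support of a measure. -/
def msupport {Z : Type*} [TopologicalSpace Z] [MeasurableSpace Z] (μ : Measure Z) : Set Z :=
  {x | ∀ U : Set Z, IsOpen U → x ∈ U → 0 < μ U}

/-- Membership in `Π(≪ μ, ν)`. -/
def MemPiAC (μ : Measure X) (ν : Measure Y) (π : ProbabilityMeasure (X × Y)) : Prop :=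
  (π : Measure (X × Y)).fst ≪ μ ∧ (π : Measure (X × Y)).snd = ν

/-- Membership in `Π(Supp(μ), ν)`. -/
def MemPiSupp (μ : Measure X) (ν : Measure Y) (π : ProbabilityMeasure (X × Y)) : Prop :=
  (π : Measure (X × Y)).fst (msupport μ) = 1 ∧ (π : Measure (X × Y)).snd = ν

variable [Nonempty Y]

/-- The disintegration kernel `π^x` of `π` with respect to its first marginal, as a
finite (probability) measure. -/
def condFM (π : ProbabilityMeasure (X × Y)) (x : X) : FiniteMeasure Y :=
  ⟨(π : Measure (X × Y)).condKernel x, inferInstance⟩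

/-- The measure `(dπ₁/dμ)(x) • π^x`. -/
def fiber (μ : Measure X) (π : ProbabilityMeasure (X × Y)) (x : X) : FiniteMeasure Y :=
  ((π : Measure (X × Y)).fst.rnDeriv μ x).toNNReal • condFM π x

/-- The functional `I_c^μ[π] = ∫ c(x, (dπ₁/dμ)(x) π^x) dμ`, in `ℝ ∪ {+∞}`. -/
def Icmu (c : X → FiniteMeasure Y → ℝ) (μ : Measure X) (π : ProbabilityMeasure (X × Y)) :
    EReal :=
  eintegralR μ fun x => c x (fiber μ π x)

/-- A strong solution of the transport problem. -/
def IsStrongSol (c : X → FiniteMeasure Y → ℝ) (μ : Measure X) (ν : Measure Y)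
    (π : ProbabilityMeasure (X × Y)) : Prop :=
  MemPiAC μ ν π ∧ Icmu c μ π = transportCost c μ ν

/-- A weak solution of the transport problem. -/
def IsWeakSol (c : X → FiniteMeasure Y → ℝ) (μ : Measure X) (ν : Measure Y)
    (π : ProbabilityMeasure (X × Y)) : Prop :=
  ∃ s : ℕ → ProbabilityMeasure (X × Y), (∀ n, MemPiAC μ ν (s n)) ∧
    Tendsto s atTop (𝓝 π) ∧
    Tendsto (fun n => Icmu c μ (s n)) atTop (𝓝 (transportCost c μ ν))

/-- The recession function `c'_∞(x,m) = lim_{λ→∞} c(x, λm)/λ`. -/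
def recession (c : X → FiniteMeasure Y → ℝ) (x : X) (m : FiniteMeasure Y) : EReal :=
  limsup (fun lam : ℝ≥0 => ((c x (lam • m) / (lam : ℝ) : ℝ) : EReal)) atTop

/-- The extended functional `bar I_c^μ[π]`. -/
def barI (c : X → FiniteMeasure Y → ℝ) (μ : Measure X) (π : ProbabilityMeasure (X × Y)) :
    EReal :=
  eintegralR μ (fun x => c x (fiber μ π x)) +
    eintegral ((π : Measure (X × Y)).fst.singularPart μ) (fun x => recession c x (condFM π x))

/-- Assumption (A). -/
def AssumpA (c : X → FiniteMeasure Y → ℝ) : Prop :=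
  ∃ (a : ℕ → C(X, ℝ)) (b : ℕ → C(X × Y, ℝ)),
    ∀ (x : X) (m : FiniteMeasure Y),
      IsLUB (range fun k => (∫ y, b k (x, y) ∂(m : Measure Y)) + a k x) (c x m)

/-- Assumption (B). -/
def AssumpB (c : X → FiniteMeasure Y → ℝ) : Prop :=
  ∀ (x : X) (m : FiniteMeasure Y), m ≠ 0 →
    Tendsto (fun lam : ℝ≥0 => c x (lam • m) / (lam : ℝ)) atTop atTop

/-- Assumption (C). -/
def AssumpC (c : X → FiniteMeasure Y → ℝ) : Prop :=
  (∀ m : FiniteMeasure Y, Continuous fun x : X => c x m) ∧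
  (∀ m : FiniteMeasure Y, Continuous fun x : X => recession c x m) ∧
  (∃ a : ℝ, 0 ≤ a ∧
    ∀ (x : X) (p : FiniteMeasure Y), p.mass = 1 → recession c x p ≤ (a : EReal))

/-- Assumption (Approx). -/
def AssumpApprox (c : X → FiniteMeasure Y → ℝ) : Prop :=
  ∀ (μ : Measure X) (ν : Measure Y), IsProbabilityMeasure μ → IsProbabilityMeasure ν →
    ∀ π : ProbabilityMeasure (X × Y), MemPiSupp μ ν π →
      ∃ s : ℕ → ProbabilityMeasure (X × Y), (∀ n, MemPiAC μ ν (s n)) ∧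
        Tendsto (fun n => Icmu c μ (s n)) atTop (𝓝 (barI c μ π))

/-- The operator `K_c` acting on continuous functions. -/
def Kc (c : X → FiniteMeasure Y → ℝ) (f : Y → ℝ) (x : X) : EReal :=
  ⨅ m : FiniteMeasure Y, (((∫ y, f y ∂(m : Measure Y)) + c x m : ℝ) : EReal)


theorem epos_coe (r : ℝ) : epos (r : EReal) = ENNReal.ofReal r := by
  simp [epos]

theorem eintegralR_eq_integral {α : Type*} [MeasurableSpace α] {μ : Measure α} {f : α → ℝ}
    (hf : Integrable f μ) : eintegralR μ f = ((∫ x, f x ∂μ : ℝ) : EReal) := by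
  have hpos : ∫⁻ x, ENNReal.ofReal (f x) ∂μ ≠ ⊤ := hf.lintegral_lt_top.ne
  have hneg : ∫⁻ x, ENNReal.ofReal (-f x) ∂μ ≠ ⊤ := (Integrable.neg hf).lintegral_lt_top.ne
  simp only [eintegralR, eintegral, ← EReal.coe_neg, epos_coe]
  rw [integral_eq_lintegral_pos_part_sub_lintegral_neg_part hf, EReal.coe_sub,
    EReal.coe_ennreal_toReal hpos, EReal.coe_ennreal_toReal hneg]

theorem _root_.ContinuousMap.integrable_of_isFiniteMeasure {Z : Type*} [TopologicalSpace Z]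
    [CompactSpace Z] [MeasurableSpace Z] [BorelSpace Z] (ρ : Measure Z) [IsFiniteMeasure ρ]
    (f : C(Z, ℝ)) : Integrable f ρ :=
  (BoundedContinuousFunction.mkOfCompact f).integrable ρ

section Selection

variable {Z : Type*} [TopologicalSpace Z] [PolishSpace Z] [MeasurableSpace Z] [BorelSpace Z]
  {τ : Measure Z}

/-- The maximum of two integrable functions is an `L¹` limit of convex combinations of these
functions with continuous weights. -/
theorem exists_continuous_weight_integral_max_sub_le
    {f g : Z → ℝ}
    (hfm : Measurable f) (hgm : Measurable g) (hf : Integrable f τ) (hg : Integrable g τ)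
    {ε : ℝ} (hε : 0 < ε) :
    ∃ χ : C(Z, ℝ), (∀ x, 0 ≤ χ x ∧ χ x ≤ 1) ∧
      ∫ x, |max (f x) (g x) - (χ x * f x + (1 - χ x) * g x)| ∂τ ≤ ε := by
  classical
  set d : Z → ℝ≥0 := fun x => ‖f x - g x‖₊ with hd
  have hdm : Measurable d := (hfm.sub hgm).nnnorm
  set ρ := τ.withDensity fun x => (d x : ℝ≥0∞) with hρ
  have hρfin : IsFiniteMeasure ρ :=
    isFiniteMeasure_withDensity (hf.sub hg).hasFiniteIntegral.ne
  have hA : MeasurableSet {x | g x ≤ f x} := measurableSet_le hgm hfm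
  set φ : Z → ℝ := indicator {x | g x ≤ f x} 1 with hφ
  have hφi : Integrable φ ρ := (integrable_const (1 : ℝ)).indicator hA
  obtain ⟨ψ, hψ, hψi⟩ := hφi.exists_boundedContinuous_integral_sub_le hε
  refine ⟨⟨fun x => max 0 (min 1 (ψ x)), by fun_prop⟩, fun x => ⟨?_, ?_⟩, ?_⟩
  · simp
  · simp
  refine le_trans ?_ hψ
  rw [hρ, integral_withDensity_eq_integral_smul hdm]
  refine integral_mono_of_nonneg (ae_of_all _ fun x => abs_nonneg _) ?_
    (ae_of_all _ fun x => ?_)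
  · rw [← integrable_withDensity_iff_integrable_smul hdm]
    exact (hφi.sub hψi).norm
  · simp only [ContinuousMap.coe_mk, NNReal.smul_def, smul_eq_mul, hd, coe_nnnorm,
      Real.norm_eq_abs]
    have key : max (f x) (g x) - (max 0 (min 1 (ψ x)) * f x + (1 - max 0 (min 1 (ψ x))) * g x)
        = (f x - g x) * (φ x - max 0 (min 1 (ψ x))) := by
      by_cases h : g x ≤ f x
      · simp only [hφ, indicator, mem_ofPred_eq, h, if_true, max_eq_left, Pi.one_apply]; ring
      · simp only [hφ, indicator, mem_ofPred_eq, h, if_false, max_eq_right (le_of_not_ge h)]; ring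
    rw [key, abs_mul]
    refine mul_le_mul_of_nonneg_left ?_ (abs_nonneg _)
    have h01 : φ x = max 0 (min 1 (φ x)) := by
      by_cases h : g x ≤ f x <;> simp [hφ, h]
    calc |φ x - max 0 (min 1 (ψ x))|
        = |max 0 (min 1 (φ x)) - max 0 (min 1 (ψ x))| := by rw [← h01]
      _ ≤ |min 1 (φ x) - min 1 (ψ x)| := by
        simpa using abs_max_sub_max_le_max (0 : ℝ) (min 1 (φ x)) 0 (min 1 (ψ x))
      _ ≤ |φ x - ψ x| := by simpa using abs_min_sub_min_le_max (1 : ℝ) (φ x) 1 (ψ x)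

/-- If a family of integrable functions is stable under convex combinations with continuous
weights, the integral of a countable supremum of its members is approached by integrals of
members of the family. -/
theorem exists_integral_sub_le_of_isLUB
    {ι : Type*} {g : ι → Z → ℝ} (hgm : ∀ i, Measurable (g i)) (hg : ∀ i, Integrable (g i) τ)
    (hcomb : ∀ i j, ∀ χ : C(Z, ℝ), (∀ x, 0 ≤ χ x ∧ χ x ≤ 1) →
      ∃ l, ∀ x, g l x = χ x * g i x + (1 - χ x) * g j x)
    (k : ℕ → ι) {G : Z → ℝ} (hG : Integrable G τ)
    (hlub : ∀ x, IsLUB (range fun n => g (k n) x) (G x)) {ε : ℝ} (hε : 0 < ε) :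
    ∃ i, ∫ x, G x ∂τ - ε ≤ ∫ x, g i x ∂τ := by
  set M : ℕ → Z → ℝ := fun n x => partialSups (fun n => g (k n) x) n with hM
  have hM0 : ∀ x, M 0 x = g (k 0) x := fun x => by simp [hM]
  have hMs : ∀ n x, M (n + 1) x = max (M n x) (g (k (n + 1)) x) := fun n x => by
    simp [hM, partialSups_add_one]
  have hMi : ∀ n, Integrable (M n) τ := by
    intro n
    induction n with
    | zero => exact (hg (k 0)).congr (ae_of_all _ fun x => (hM0 x).symm)
    | succ n ih => exact (ih.sup (hg (k (n + 1)))).congr (ae_of_all _ fun x => (hMs n x).symm)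
  have happrox : ∀ n, ∀ δ > 0, ∃ l, ∫ x, |M n x - g l x| ∂τ ≤ δ := by
    intro n
    induction n with
    | zero => intro δ hδ; exact ⟨k 0, by simpa [hM0] using hδ.le⟩
    | succ n ih =>
      intro δ hδ
      obtain ⟨i, hi⟩ := ih (δ / 2) (half_pos hδ)
      obtain ⟨χ, hχ, hχ'⟩ := exists_continuous_weight_integral_max_sub_le (hgm i)
        (hgm (k (n + 1))) (hg i) (hg (k (n + 1))) (half_pos hδ)
      obtain ⟨l, hl⟩ := hcomb i (k (n + 1)) χ hχ
      simp only [← hl] at hχ'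
      refine ⟨l, ?_⟩
      have h1 : Integrable (fun x => |M n x - g i x|) τ := ((hMi n).sub (hg i)).abs
      have h2 : Integrable (fun x => |max (g i x) (g (k (n + 1)) x) - g l x|) τ :=
        (((hg i).sup (hg (k (n + 1)))).sub (hg l)).abs
      calc ∫ x, |M (n + 1) x - g l x| ∂τ
          ≤ ∫ x, (|M n x - g i x| + |max (g i x) (g (k (n + 1)) x) - g l x|) ∂τ := by
            refine integral_mono ((hMi _).sub (hg l)).abs (h1.add h2) fun x => ?_
            simp only [hMs]
            refine (abs_sub_le _ (max (g i x) (g (k (n + 1)) x)) _).trans ?_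
            refine add_le_add ?_ le_rfl
            simpa using abs_max_sub_max_le_max (M n x) (g (k (n + 1)) x) (g i x) (g (k (n + 1)) x)
        _ ≤ δ := by rw [integral_add h1 h2]; linarith
  have hlim : Tendsto (fun n => ∫ x, M n x ∂τ) atTop (𝓝 (∫ x, G x ∂τ)) := by
    refine integral_tendsto_of_tendsto_of_monotone hMi hG (ae_of_all _ fun x => ?_)
      (ae_of_all _ fun x => ?_)
    · exact (partialSups _).monotone
    · refine tendsto_atTop_isLUB (partialSups _).monotone ⟨?_, fun b hb => ?_⟩
      · rintro _ ⟨n, rfl⟩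
        exact partialSups_le _ _ _ fun m _ => (hlub x).1 ⟨m, rfl⟩
      · refine (hlub x).2 ?_
        rintro _ ⟨n, rfl⟩
        exact (le_partialSups (fun n => g (k n) x) n).trans (hb ⟨n, rfl⟩)
  obtain ⟨n, hn⟩ := (hlim.eventually (lt_mem_nhds
    (show ∫ x, G x ∂τ - ε / 2 < ∫ x, G x ∂τ by linarith))).exists
  obtain ⟨l, hl⟩ := happrox n (ε / 2) (half_pos hε)
  refine ⟨l, ?_⟩
  have : ∫ x, M n x ∂τ - ∫ x, g l x ∂τ ≤ ∫ x, |M n x - g l x| ∂τ := by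
    rw [← integral_sub (hMi n) (hg l)]
    exact integral_mono ((hMi n).sub (hg l)) ((hMi n).sub (hg l)).abs fun x => le_abs_self _
  linarith

end Selection

section BallKernel

variable {Z : Type*} [TopologicalSpace Z] [MeasurableSpace Z]

theorem isClosed_msupport (μ : Measure Z) : IsClosed (msupport μ) := by
  rw [← isOpen_compl_iff, isOpen_iff_forall_mem_open]
  intro x hx
  simp only [msupport, mem_compl_iff, mem_ofPred_eq, not_forall] at hx
  obtain ⟨U, hU, hxU, hμ⟩ := hx
  exact ⟨U, fun y hy h => hμ (h U hU hy), hU, hxU⟩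

/-- Kernels that smooth points of the support of `μ` into nearby absolutely continuous
probability measures. -/
theorem exists_kernel_tendsto_of_mem_msupport [PolishSpace Z] [BorelSpace Z]
    [CompactSpace Z] (μ : Measure Z)
    [IsProbabilityMeasure μ] :
    ∃ K : ℕ → Kernel Z Z, (∀ n, IsMarkovKernel (K n)) ∧ (∀ n y, K n y ≪ μ) ∧
      ∀ y ∈ msupport μ, ∀ h : Z → ℝ, Continuous h →
        Tendsto (fun n => ∫ x, h x ∂K n y) atTop (𝓝 (h y)) := by
  classical
  let := TopologicalSpace.upgradeIsCompletelyMetrizable Z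
  set ε : ℕ → ℝ := fun n => 1 / ((n : ℝ) + 1) with hε
  have hball : ∀ n, ∀ s, MeasurableSet s → Measurable fun y => μ (ball y (ε n) ∩ s) := by
    intro n s hs
    have hS : MeasurableSet {p : Z × Z | dist p.2 p.1 < ε n ∧ p.2 ∈ s} :=
      (measurableSet_lt (measurable_snd.dist measurable_fst) measurable_const).inter
        (measurable_snd hs)
    exact measurable_measure_prodMk_left hS
  have hball' : ∀ n, Measurable fun y => μ (ball y (ε n)) := fun n => by
    simpa using hball n univ MeasurableSet.univ
  set q : ℕ → Z → Measure Z := fun n y =>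
    if μ (ball y (ε n)) = 0 then μ else cond μ (ball y (ε n)) with hq
  have hqm : ∀ n, Measurable (q n) := by
    intro n
    refine Measure.measurable_of_measurable_coe _ fun s hs => ?_
    have : (fun y => q n y s) = fun y => if μ (ball y (ε n)) = 0 then μ s else
        (μ (ball y (ε n)))⁻¹ * μ (ball y (ε n) ∩ s) := by
      ext y
      by_cases h : μ (ball y (ε n)) = 0
      · simp [hq, h]
      · simp only [hq, h, if_false]
        rw [cond_apply measurableSet_ball]
    rw [this]
    exact Measurable.ite (hball' n (measurableSet_singleton 0)) measurable_const
      ((hball' n).inv.mul (hball n s hs))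
  have hqp : ∀ n y, IsProbabilityMeasure (q n y) := by
    intro n y
    by_cases h : μ (ball y (ε n)) = 0
    · simpa [hq, h]
    · simpa [hq, h] using cond_isProbabilityMeasure h
  refine ⟨fun n => ⟨q n, hqm n⟩, fun n => ⟨hqp n⟩, fun n y => ?_, fun y hy h hh => ?_⟩
  · change q n y ≪ μ
    by_cases h : μ (ball y (ε n)) = 0
    · simp [hq, h, Measure.AbsolutelyContinuous.rfl]
    · simpa [hq, h] using cond_absolutelyContinuous
  · change Tendsto (fun n => ∫ x, h x ∂q n y) atTop (𝓝 (h y))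
    rw [Metric.tendsto_atTop]
    intro δ hδ
    obtain ⟨r, hr, hr'⟩ := Metric.continuousAt_iff.1 (hh.continuousAt (x := y)) (δ / 2)
      (half_pos hδ)
    obtain ⟨N, hN⟩ := exists_nat_one_div_lt hr
    refine ⟨N, fun n hn => ?_⟩
    have hεn : ε n < r := (Nat.one_div_le_one_div hn).trans_lt hN
    have hε0 : 0 < ε n := Nat.one_div_pos_of_nat
    have hpos : μ (ball y (ε n)) ≠ 0 := (hy _ isOpen_ball (mem_ball_self hε0)).ne'
    have hae : ∀ᵐ x ∂q n y, ‖h x - h y‖ ≤ δ / 2 := by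
      have : q n y = cond μ (ball y (ε n)) := by simp [hq, hpos]
      rw [this]
      filter_upwards [ae_cond_mem measurableSet_ball] with x hx
      exact (hr' (lt_trans hx hεn)).le
    have hi : Integrable h (q n y) :=
      ContinuousMap.integrable_of_isFiniteMeasure (q n y) ⟨h, hh⟩
    have hsub : ∫ x, h x ∂q n y - h y = ∫ x, (h x - h y) ∂q n y := by
      rw [integral_sub hi (integrable_const _)]; simp
    rw [dist_eq_norm, hsub]
    refine (norm_integral_le_of_norm_le_const hae).trans_lt ?_
    simp only [probReal_univ]
    linarith

/-- Convergence of averages under a smoothing sequence of kernels. -/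
theorem tendsto_integral_integral_kernel {K : ℕ → Kernel Z Z} [∀ n, IsMarkovKernel (K n)]
    {σ : Measure Z} [IsFiniteMeasure σ]
    (hK : ∀ᵐ y ∂σ, ∀ h : Z → ℝ, Continuous h →
      Tendsto (fun n => ∫ x, h x ∂K n y) atTop (𝓝 (h y)))
    {f : Z × Z → ℝ} (hfm : Measurable f) (hfc : ∀ y, Continuous fun x => f (y, x)) {C : ℝ}
    (hC : ∀ p, |f p| ≤ C) :
    Tendsto (fun n => ∫ y, ∫ x, f (y, x) ∂K n y ∂σ) atTop (𝓝 (∫ y, f (y, y) ∂σ)) := by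
  refine tendsto_integral_of_dominated_convergence (fun _ => C) (fun n => ?_)
    (integrable_const C) (fun n => ae_of_all _ fun y => ?_) ?_
  · exact hfm.stronglyMeasurable.integral_kernel_prod_right'.aestronglyMeasurable
  · simpa using norm_integral_le_of_norm_le_const (μ := K n y) (f := fun x => f (y, x))
      (ae_of_all _ fun x => hC (y, x))
  · filter_upwards [hK] with y hy using hy _ (hfc y)

end BallKernel

set_option linter.unusedSectionVars false

/-- The pair `(b, a)` defines an affine minorant of the cost `c` in the second variable. -/
def IsMinorant (c : X → FiniteMeasure Y → ℝ) (b : C(X × Y, ℝ)) (a : C(X, ℝ)) : Prop :=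
  ∀ (x : X) (m : FiniteMeasure Y), (∫ y, b (x, y) ∂(m : Measure Y)) + a x ≤ c x m

theorem integral_nnreal_smul (lam : ℝ≥0) (m : FiniteMeasure Y) (f : Y → ℝ) :
    ∫ y, f y ∂((lam • m : FiniteMeasure Y) : Measure Y) = lam * ∫ y, f y ∂(m : Measure Y) := by
  rw [FiniteMeasure.toMeasure_smul, integral_smul_nnreal_measure, NNReal.smul_def, smul_eq_mul]

theorem tendsto_coe_add_div_nnreal (s t : ℝ) :
    Tendsto (fun lam : ℝ≥0 => ((s + t / (lam : ℝ) : ℝ) : EReal)) atTop (𝓝 (s : EReal)) := by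
  refine (continuous_coe_real_ereal.tendsto s).comp ?_
  simpa using (tendsto_const_nhds (x := s)).add
    ((tendsto_const_nhds (x := t)).div_atTop (NNReal.tendsto_coe_atTop.2 tendsto_id))

theorem IsMinorant.integral_le_recession {c : X → FiniteMeasure Y → ℝ} {b : C(X × Y, ℝ)}
    {a : C(X, ℝ)} (h : IsMinorant c b a) (x : X) (m : FiniteMeasure Y) :
    ((∫ y, b (x, y) ∂(m : Measure Y) : ℝ) : EReal) ≤ recession c x m := by
  rw [← (tendsto_coe_add_div_nnreal (∫ y, b (x, y) ∂(m : Measure Y)) (a x)).limsup_eq]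
  refine limsup_le_limsup ?_
  filter_upwards [eventually_gt_atTop 0] with lam hlam
  have hlam' : (0 : ℝ) < lam := hlam
  have := h x (lam • m)
  rw [integral_nnreal_smul] at this
  rw [EReal.coe_le_coe_iff, le_div_iff₀ hlam', add_mul, div_mul_cancel₀ _ hlam'.ne']
  linarith

section Representation

variable {c : X → FiniteMeasure Y → ℝ} {a : ℕ → C(X, ℝ)} {b : ℕ → C(X × Y, ℝ)}

theorem isMinorant_of_isLUB (h : ∀ (x : X) (m : FiniteMeasure Y),
      IsLUB (range fun k => (∫ y, b k (x, y) ∂(m : Measure Y)) + a k x) (c x m)) (k : ℕ) :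
    IsMinorant c (b k) (a k) :=
  fun x m => (h x m).1 ⟨k, rfl⟩

theorem recession_le_of_isLUB (h : ∀ (x : X) (m : FiniteMeasure Y),
      IsLUB (range fun k => (∫ y, b k (x, y) ∂(m : Measure Y)) + a k x) (c x m))
    {x : X} {m : FiniteMeasure Y} {S : ℝ} (hS : ∀ k, ∫ y, b k (x, y) ∂(m : Measure Y) ≤ S) :
    recession c x m ≤ S := by
  rw [← (tendsto_coe_add_div_nnreal S (c x 0)).limsup_eq]
  refine limsup_le_limsup ?_
  filter_upwards [eventually_gt_atTop 0] with lam hlam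
  have hlam' : (0 : ℝ) < lam := hlam
  rw [EReal.coe_le_coe_iff, div_le_iff₀ hlam', add_mul, div_mul_cancel₀ _ hlam'.ne']
  refine (h x (lam • m)).2 ?_
  rintro _ ⟨k, rfl⟩
  have h0 : a k x ≤ c x 0 := by simpa using isMinorant_of_isLUB h k x 0
  simp only [integral_nnreal_smul]
  nlinarith [hS k]

theorem coe_toReal_recession (h : ∀ (x : X) (m : FiniteMeasure Y),
      IsLUB (range fun k => (∫ y, b k (x, y) ∂(m : Measure Y)) + a k x) (c x m))
    {x : X} {m : FiniteMeasure Y} {A : ℝ} (hA : recession c x m ≤ A) :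
    ((recession c x m).toReal : EReal) = recession c x m :=
  EReal.coe_toReal (ne_top_of_le_ne_top (EReal.coe_ne_top A) hA)
    (ne_bot_of_le_ne_bot (EReal.coe_ne_bot _)
      ((isMinorant_of_isLUB h 0).integral_le_recession x m))

theorem isLUB_toReal_recession (h : ∀ (x : X) (m : FiniteMeasure Y),
      IsLUB (range fun k => (∫ y, b k (x, y) ∂(m : Measure Y)) + a k x) (c x m))
    {x : X} {m : FiniteMeasure Y} {A : ℝ} (hA : recession c x m ≤ A) :
    IsLUB (range fun k => ∫ y, b k (x, y) ∂(m : Measure Y)) (recession c x m).toReal := by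
  constructor
  · rintro _ ⟨k, rfl⟩
    rw [← EReal.coe_le_coe_iff, coe_toReal_recession h hA]
    exact (isMinorant_of_isLUB h k).integral_le_recession x m
  · intro S hS
    rw [← EReal.coe_le_coe_iff, coe_toReal_recession h hA]
    exact recession_le_of_isLUB h fun k => hS ⟨k, rfl⟩

end Representation

theorem IsMinorant.convexComb {c : X → FiniteMeasure Y → ℝ} {b b' : C(X × Y, ℝ)}
    {a a' : C(X, ℝ)} [CompactSpace Y] (h : IsMinorant c b a) (h' : IsMinorant c b' a')
    {χ : C(X, ℝ)} (hχ : ∀ x, 0 ≤ χ x ∧ χ x ≤ 1) :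
    IsMinorant c
      (χ.comp ⟨Prod.fst, continuous_fst⟩ * b + (1 - χ.comp ⟨Prod.fst, continuous_fst⟩) * b')
      (χ * a + (1 - χ) * a') := by
  intro x m
  have hi : ∀ f : C(X × Y, ℝ), Integrable (fun y => f (x, y)) (m : Measure Y) := fun f =>
    (f.comp ⟨fun y => (x, y), by fun_prop⟩).integrable_of_isFiniteMeasure _
  simp only [ContinuousMap.add_apply, ContinuousMap.mul_apply, ContinuousMap.comp_apply,
    ContinuousMap.coe_mk, ContinuousMap.sub_apply, ContinuousMap.one_apply]
  rw [integral_add ((hi b).const_mul _) ((hi b').const_mul _), integral_const_mul,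
    integral_const_mul]
  nlinarith [h x m, h' x m, hχ x]

theorem integral_fiber (μ : Measure X) (π : ProbabilityMeasure (X × Y)) (x : X) (f : Y → ℝ) :
    ∫ y, f y ∂(fiber μ π x : Measure Y) =
      ((π : Measure (X × Y)).fst.rnDeriv μ x).toReal *
        ∫ y, f y ∂(π : Measure (X × Y)).condKernel x :=
  integral_nnreal_smul _ _ _

theorem mass_condFM (π : ProbabilityMeasure (X × Y)) (x : X) : (condFM π x).mass = 1 := by
  rw [← ENNReal.coe_inj, FiniteMeasure.ennreal_mass]
  exact measure_univ (μ := (π : Measure (X × Y)).condKernel x)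

section Disintegration

variable [CompactSpace X] [CompactSpace Y]

theorem measurable_integral_condKernel (π : ProbabilityMeasure (X × Y)) (f : C(X × Y, ℝ)) :
    Measurable fun p : X × X =>
      ∫ y, f (p.2, y) ∂(π : Measure (X × Y)).condKernel p.1 := by
  have : StronglyMeasurable fun q : (X × X) × Y => f (q.1.2, q.2) :=
    (f.continuous.comp (by fun_prop)).stronglyMeasurable
  exact (this.integral_kernel_prod_right'
    (κ := (π : Measure (X × Y)).condKernel.comap Prod.fst measurable_fst)).measurable

theorem abs_integral_le_norm {ρ : Measure Y} [IsProbabilityMeasure ρ] (f : C(X × Y, ℝ)) (x : X) :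
    |∫ y, f (x, y) ∂ρ| ≤ ‖f‖ := by
  simpa using norm_integral_le_of_norm_le_const (μ := ρ) (f := fun y => f (x, y))
    (ae_of_all _ fun y => f.norm_coe_le_norm (x, y))

theorem measurable_integral_condKernel_diag (π : ProbabilityMeasure (X × Y))
    (f : C(X × Y, ℝ)) :
    Measurable fun x => ∫ y, f (x, y) ∂(π : Measure (X × Y)).condKernel x :=
  (measurable_integral_condKernel π f).comp (measurable_id.prodMk measurable_id)

theorem integrable_integral_condKernel (π : ProbabilityMeasure (X × Y)) (f : C(X × Y, ℝ))
    (ρ : Measure X) [IsFiniteMeasure ρ] :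
    Integrable (fun x => ∫ y, f (x, y) ∂(π : Measure (X × Y)).condKernel x) ρ :=
  Integrable.of_bound (measurable_integral_condKernel_diag π f).aestronglyMeasurable ‖f‖
    (ae_of_all _ fun x => abs_integral_le_norm f x)

theorem integrable_rnDeriv_mul_integral_condKernel (μ : Measure X) [IsFiniteMeasure μ]
    (π : ProbabilityMeasure (X × Y)) (f : C(X × Y, ℝ)) :
    Integrable (fun x => ((π : Measure (X × Y)).fst.rnDeriv μ x).toReal *
      ∫ y, f (x, y) ∂(π : Measure (X × Y)).condKernel x) μ :=
  Measure.integrable_toReal_rnDeriv.mul_bdd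
    (measurable_integral_condKernel_diag π f).aestronglyMeasurable
    (ae_of_all _ fun x => abs_integral_le_norm f x)

theorem integral_eq_integral_rnDeriv_add_integral_singularPart (μ : Measure X)
    [IsFiniteMeasure μ] (π : ProbabilityMeasure (X × Y)) (f : C(X × Y, ℝ)) :
    ∫ p, f p ∂(π : Measure (X × Y)) =
      ∫ x, ((π : Measure (X × Y)).fst.rnDeriv μ x).toReal *
        ∫ y, f (x, y) ∂(π : Measure (X × Y)).condKernel x ∂μ +
      ∫ x, ∫ y, f (x, y) ∂(π : Measure (X × Y)).condKernel x
        ∂(π : Measure (X × Y)).fst.singularPart μ := by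
  set ρ : Measure (X × Y) := (π : Measure (X × Y)) with hρ
  have h1 : ∫ p, f p ∂ρ = ∫ x, ∫ y, f (x, y) ∂ρ.condKernel x ∂ρ.fst := by
    rw [← Measure.integral_compProd, ρ.disintegrate ρ.condKernel]
    rw [ρ.disintegrate ρ.condKernel]
    exact f.integrable_of_isFiniteMeasure ρ
  have hB := fun τ : Measure X => fun _ : IsFiniteMeasure τ =>
    integrable_integral_condKernel π f τ
  have hfin : IsFiniteMeasure (μ.withDensity (ρ.fst.rnDeriv μ)) :=
    isFiniteMeasure_withDensity (Measure.lintegral_rnDeriv_lt_top _ _).ne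
  conv_lhs => rw [h1, ← Measure.singularPart_add_rnDeriv ρ.fst μ]
  rw [integral_add_measure (hB _ inferInstance) (hB _ hfin), add_comm,
    integral_withDensity_eq_integral_toReal_smul (Measure.measurable_rnDeriv _ _)
      (Measure.rnDeriv_lt_top _ _)]
  rfl

end Disintegration

section Duality

variable [CompactSpace X] [CompactSpace Y] {c : X → FiniteMeasure Y → ℝ} {a : ℕ → C(X, ℝ)}
  {b : ℕ → C(X × Y, ℝ)} {A : ℝ}

theorem measurable_toReal_recession (h : ∀ (x : X) (m : FiniteMeasure Y),
      IsLUB (range fun k => (∫ y, b k (x, y) ∂(m : Measure Y)) + a k x) (c x m))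
    (hA : ∀ (x : X) (p : FiniteMeasure Y), p.mass = 1 → recession c x p ≤ A)
    (π : ProbabilityMeasure (X × Y)) :
    Measurable fun p : X × X => (recession c p.2 (condFM π p.1)).toReal :=
  Measurable.isLUB (fun k => measurable_integral_condKernel π (b k)) fun p =>
    isLUB_toReal_recession h (hA p.2 _ (mass_condFM π p.1))

theorem abs_toReal_recession_le (h : ∀ (x : X) (m : FiniteMeasure Y),
      IsLUB (range fun k => (∫ y, b k (x, y) ∂(m : Measure Y)) + a k x) (c x m))
    (hA : ∀ (x : X) (p : FiniteMeasure Y), p.mass = 1 → recession c x p ≤ A)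
    (π : ProbabilityMeasure (X × Y)) (p : X × X) :
    |(recession c p.2 (condFM π p.1)).toReal| ≤ max ‖b 0‖ A := by
  have hp := hA p.2 _ (mass_condFM π p.1)
  rw [abs_le]
  constructor
  · have h0 := (isLUB_toReal_recession h hp).1 ⟨0, rfl⟩
    have h1 := (abs_le.1 (abs_integral_le_norm
      (ρ := (π : Measure (X × Y)).condKernel p.1) (b 0) p.2)).1
    exact (neg_le_neg (le_max_left _ _)).trans (h1.trans h0)
  · refine le_trans ?_ (le_max_right _ _)
    rwa [← EReal.coe_le_coe_iff, coe_toReal_recession h hp]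

theorem integrable_toReal_recession_condFM (h : ∀ (x : X) (m : FiniteMeasure Y),
      IsLUB (range fun k => (∫ y, b k (x, y) ∂(m : Measure Y)) + a k x) (c x m))
    (hA : ∀ (x : X) (p : FiniteMeasure Y), p.mass = 1 → recession c x p ≤ A)
    (π : ProbabilityMeasure (X × Y)) (ρ : Measure X) [IsFiniteMeasure ρ] :
    Integrable (fun x => (recession c x (condFM π x)).toReal) ρ :=
  Integrable.of_bound ((measurable_toReal_recession h hA π).comp
      (measurable_id.prodMk measurable_id)).aestronglyMeasurable (max ‖b 0‖ A)
    (ae_of_all _ fun x => abs_toReal_recession_le h hA π (x, x))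

theorem measurable_cost_fiber (h : ∀ (x : X) (m : FiniteMeasure Y),
      IsLUB (range fun k => (∫ y, b k (x, y) ∂(m : Measure Y)) + a k x) (c x m))
    (μ : Measure X) (π : ProbabilityMeasure (X × Y)) :
    Measurable fun x => c x (fiber μ π x) := by
  refine Measurable.isLUB (f := fun k x => (∫ y, b k (x, y) ∂(fiber μ π x : Measure Y)) + a k x)
    (fun k => ?_) fun x => h x _
  simp only [integral_fiber]
  exact ((Measure.measurable_rnDeriv _ _).ennreal_toReal.mul
    (measurable_integral_condKernel_diag π (b k))).add (a k).continuous.measurable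

theorem integrable_cost_fiber (h : ∀ (x : X) (m : FiniteMeasure Y),
      IsLUB (range fun k => (∫ y, b k (x, y) ∂(m : Measure Y)) + a k x) (c x m))
    (hA : ∀ (x : X) (p : FiniteMeasure Y), p.mass = 1 → recession c x p ≤ A)
    (hc : Continuous fun x => c x 0) (μ : Measure X) [IsFiniteMeasure μ]
    (π : ProbabilityMeasure (X × Y)) :
    Integrable (fun x => c x (fiber μ π x)) μ := by
  refine integrable_of_le_of_le (measurable_cost_fiber h μ π).aestronglyMeasurable
    (g₁ := fun x => ((π : Measure (X × Y)).fst.rnDeriv μ x).toReal *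
      (∫ y, b 0 (x, y) ∂(π : Measure (X × Y)).condKernel x) + a 0 x)
    (g₂ := fun x => ((π : Measure (X × Y)).fst.rnDeriv μ x).toReal * A + c x 0)
    (ae_of_all _ fun x => ?_) (ae_of_all _ fun x => ?_) ?_ ?_
  · beta_reduce
    rw [← integral_fiber]
    exact (h x _).1 ⟨0, rfl⟩
  · refine (h x _).2 ?_
    rintro _ ⟨k, rfl⟩
    simp only [integral_fiber]
    have h0 : a k x ≤ c x 0 := by simpa using isMinorant_of_isLUB h k x 0
    have h1 : ∫ y, b k (x, y) ∂(π : Measure (X × Y)).condKernel x ≤ A := by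
      rw [← EReal.coe_le_coe_iff]
      exact ((isMinorant_of_isLUB h k).integral_le_recession x (condFM π x)).trans
        (hA x _ (mass_condFM π x))
    gcongr
  · exact (integrable_rnDeriv_mul_integral_condKernel μ π (b 0)).add
      ((a 0).integrable_of_isFiniteMeasure μ)
  · exact (Measure.integrable_toReal_rnDeriv.mul_const A).add
      (ContinuousMap.integrable_of_isFiniteMeasure μ ⟨_, hc⟩)

/-- The extended functional as a real number. -/
def realBarI (c : X → FiniteMeasure Y → ℝ) (μ : Measure X) (π : ProbabilityMeasure (X × Y)) : ℝ :=
  ∫ x, c x (fiber μ π x) ∂μ +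
    ∫ x, (recession c x (condFM π x)).toReal ∂(π : Measure (X × Y)).fst.singularPart μ

theorem barI_eq_realBarI (h : ∀ (x : X) (m : FiniteMeasure Y),
      IsLUB (range fun k => (∫ y, b k (x, y) ∂(m : Measure Y)) + a k x) (c x m))
    (hA : ∀ (x : X) (p : FiniteMeasure Y), p.mass = 1 → recession c x p ≤ A)
    (hc : Continuous fun x => c x 0) (μ : Measure X) [IsFiniteMeasure μ]
    (π : ProbabilityMeasure (X × Y)) :
    barI c μ π = (realBarI c μ π : EReal) := by
  rw [barI, realBarI, eintegralR_eq_integral (integrable_cost_fiber h hA hc μ π), EReal.coe_add,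
    ← eintegralR_eq_integral (integrable_toReal_recession_condFM h hA π _), eintegralR]
  simp only [coe_toReal_recession h (hA _ _ (mass_condFM π _))]

theorem Icmu_eq_realBarI (h : ∀ (x : X) (m : FiniteMeasure Y),
      IsLUB (range fun k => (∫ y, b k (x, y) ∂(m : Measure Y)) + a k x) (c x m))
    (hA : ∀ (x : X) (p : FiniteMeasure Y), p.mass = 1 → recession c x p ≤ A)
    (hc : Continuous fun x => c x 0) (μ : Measure X) [IsFiniteMeasure μ]
    (π : ProbabilityMeasure (X × Y)) (hπ : (π : Measure (X × Y)).fst ≪ μ) :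
    Icmu c μ π = (realBarI c μ π : EReal) := by
  rw [Icmu, realBarI, eintegralR_eq_integral (integrable_cost_fiber h hA hc μ π),
    Measure.singularPart_eq_zero_of_ac hπ]
  simp

theorem IsMinorant.integral_add_integral_le (h : ∀ (x : X) (m : FiniteMeasure Y),
      IsLUB (range fun k => (∫ y, b k (x, y) ∂(m : Measure Y)) + a k x) (c x m))
    (hA : ∀ (x : X) (p : FiniteMeasure Y), p.mass = 1 → recession c x p ≤ A)
    (hc : Continuous fun x => c x 0) (μ : Measure X) [IsFiniteMeasure μ]
    (π : ProbabilityMeasure (X × Y)) {b' : C(X × Y, ℝ)} {a' : C(X, ℝ)}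
    (hm : IsMinorant c b' a') :
    ∫ x, ((π : Measure (X × Y)).fst.rnDeriv μ x).toReal *
        ∫ y, b' (x, y) ∂(π : Measure (X × Y)).condKernel x ∂μ + ∫ x, a' x ∂μ ≤
      ∫ x, c x (fiber μ π x) ∂μ := by
  have h1 := integrable_rnDeriv_mul_integral_condKernel μ π b'
  have h2 := a'.integrable_of_isFiniteMeasure μ
  rw [← integral_add h1 h2]
  refine integral_mono (h1.add h2) (integrable_cost_fiber h hA hc μ π) fun x => ?_
  simp only [← integral_fiber]
  exact hm x _

theorem IsMinorant.integral_le_toReal_recession (h : ∀ (x : X) (m : FiniteMeasure Y),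
      IsLUB (range fun k => (∫ y, b k (x, y) ∂(m : Measure Y)) + a k x) (c x m))
    (hA : ∀ (x : X) (p : FiniteMeasure Y), p.mass = 1 → recession c x p ≤ A)
    (π : ProbabilityMeasure (X × Y)) {b' : C(X × Y, ℝ)} {a' : C(X, ℝ)}
    (hm : IsMinorant c b' a') (x y : X) :
    ∫ z, b' (x, z) ∂(π : Measure (X × Y)).condKernel y ≤
      (recession c x (condFM π y)).toReal := by
  rw [← EReal.coe_le_coe_iff, coe_toReal_recession h (hA _ _ (mass_condFM π _))]
  exact hm.integral_le_recession x (condFM π y)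

theorem IsMinorant.integral_add_integral_le_realBarI (h : ∀ (x : X) (m : FiniteMeasure Y),
      IsLUB (range fun k => (∫ y, b k (x, y) ∂(m : Measure Y)) + a k x) (c x m))
    (hA : ∀ (x : X) (p : FiniteMeasure Y), p.mass = 1 → recession c x p ≤ A)
    (hc : Continuous fun x => c x 0) (μ : Measure X) [IsFiniteMeasure μ]
    (π : ProbabilityMeasure (X × Y)) {b' : C(X × Y, ℝ)} {a' : C(X, ℝ)}
    (hm : IsMinorant c b' a') :
    ∫ p, b' p ∂(π : Measure (X × Y)) + ∫ x, a' x ∂μ ≤ realBarI c μ π := by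
  have h1 := hm.integral_add_integral_le h hA hc μ π
  have h2 : ∫ x, ∫ y, b' (x, y) ∂(π : Measure (X × Y)).condKernel x
      ∂(π : Measure (X × Y)).fst.singularPart μ ≤
      ∫ x, (recession c x (condFM π x)).toReal ∂(π : Measure (X × Y)).fst.singularPart μ :=
    integral_mono (integrable_integral_condKernel π b' _)
      (integrable_toReal_recession_condFM h hA π _)
      fun x => hm.integral_le_toReal_recession h hA π x x
  rw [integral_eq_integral_rnDeriv_add_integral_singularPart μ π b', realBarI]
  linarith

/-- Duality: the extended functional is approached from below by continuous affine minorants. -/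
theorem exists_isMinorant_realBarI_sub_le (h : ∀ (x : X) (m : FiniteMeasure Y),
      IsLUB (range fun k => (∫ y, b k (x, y) ∂(m : Measure Y)) + a k x) (c x m))
    (hA : ∀ (x : X) (p : FiniteMeasure Y), p.mass = 1 → recession c x p ≤ A)
    (hc : Continuous fun x => c x 0) (μ : Measure X) [IsFiniteMeasure μ]
    (π : ProbabilityMeasure (X × Y)) {ε : ℝ} (hε : 0 < ε) :
    ∃ (b' : C(X × Y, ℝ)) (a' : C(X, ℝ)), IsMinorant c b' a' ∧
      realBarI c μ π - ε ≤ ∫ p, b' p ∂(π : Measure (X × Y)) + ∫ x, a' x ∂μ := by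
  classical
  set σ := (π : Measure (X × Y)).fst.singularPart μ with hσ
  obtain ⟨N, hN, hσN, hμN⟩ := Measure.mutuallySingular_singularPart (π : Measure (X × Y)).fst μ
  have hμae : ∀ᵐ x ∂μ, x ∈ N := by rwa [← mem_ae_iff] at hμN
  have hσae : ∀ᵐ x ∂σ, x ∉ N := measure_eq_zero_iff_ae_notMem.1 hσN
  have hglue : ∀ f g : X → ℝ, Integrable f μ → Integrable g σ →
      Integrable (N.piecewise f g) (μ + σ) ∧
        ∫ x, N.piecewise f g x ∂(μ + σ) = ∫ x, f x ∂μ + ∫ x, g x ∂σ := by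
    intro f g hf hg
    have e1 : f =ᵐ[μ] N.piecewise f g := by
      filter_upwards [hμae] with x hx using (piecewise_eq_of_mem _ _ _ hx).symm
    have e2 : g =ᵐ[σ] N.piecewise f g := by
      filter_upwards [hσae] with x hx using (piecewise_eq_of_notMem _ _ _ hx).symm
    have i1 := hf.congr e1
    have i2 := hg.congr e2
    exact ⟨i1.add_measure i2,
      by rw [integral_add_measure i1 i2, integral_congr_ae e1, integral_congr_ae e2]⟩
  let B : C(X × Y, ℝ) → X → ℝ := fun f x => ∫ y, f (x, y) ∂(π : Measure (X × Y)).condKernel x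
  let r : X → ℝ := fun x => ((π : Measure (X × Y)).fst.rnDeriv μ x).toReal
  let g : {q : C(X × Y, ℝ) × C(X, ℝ) // IsMinorant c q.1 q.2} → X → ℝ := fun q =>
    N.piecewise (fun x => r x * B q.1.1 x + q.1.2 x) (B q.1.1)
  have hgi : ∀ q : {q : C(X × Y, ℝ) × C(X, ℝ) // IsMinorant c q.1 q.2},
      Integrable (fun x => r x * B q.1.1 x + q.1.2 x) μ := fun q =>
    (integrable_rnDeriv_mul_integral_condKernel μ π q.1.1).add
      (q.1.2.integrable_of_isFiniteMeasure μ)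
  have hBi : ∀ f, Integrable (B f) σ := fun f => integrable_integral_condKernel π f σ
  have hG := hglue _ _ (integrable_cost_fiber h hA hc μ π)
    (integrable_toReal_recession_condFM h hA π σ)
  obtain ⟨q, hq⟩ := exists_integral_sub_le_of_isLUB (τ := μ + σ) (g := g)
    (fun q => (((Measure.measurable_rnDeriv _ _).ennreal_toReal.mul
      (measurable_integral_condKernel_diag π q.1.1)).add
        q.1.2.continuous.measurable).piecewise hN (measurable_integral_condKernel_diag π q.1.1))
    (fun q => (hglue _ _ (hgi q) (hBi q.1.1)).1)
    (fun i j χ hχ => ⟨⟨(_, _), i.2.convexComb j.2 hχ⟩, fun x => by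
      have hi : ∀ f : C(X × Y, ℝ),
          Integrable (fun y => f (x, y)) ((π : Measure (X × Y)).condKernel x) := fun f =>
        (f.comp ⟨fun y => (x, y), by fun_prop⟩).integrable_of_isFiniteMeasure _
      have hB : B (χ.comp ⟨Prod.fst, continuous_fst⟩ * i.1.1 +
          (1 - χ.comp ⟨Prod.fst, continuous_fst⟩) * j.1.1) x =
          χ x * B i.1.1 x + (1 - χ x) * B j.1.1 x := by
        simp only [B, ContinuousMap.add_apply, ContinuousMap.mul_apply,
          ContinuousMap.comp_apply, ContinuousMap.coe_mk, ContinuousMap.sub_apply,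
          ContinuousMap.one_apply]
        rw [integral_add ((hi _).const_mul _) ((hi _).const_mul _), integral_const_mul,
          integral_const_mul]
      by_cases hx : x ∈ N
      · simp only [g, piecewise_eq_of_mem _ _ _ hx, hB, ContinuousMap.add_apply,
          ContinuousMap.mul_apply, ContinuousMap.sub_apply, ContinuousMap.one_apply]
        ring
      · simp only [g, piecewise_eq_of_notMem _ _ _ hx, hB]⟩)
    (fun k => ⟨(b k, a k), isMinorant_of_isLUB h k⟩) hG.1
    (fun x => by
      by_cases hx : x ∈ N
      · simp only [g, piecewise_eq_of_mem _ _ _ hx, r, B, ← integral_fiber]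
        exact h x _
      · simp only [g, piecewise_eq_of_notMem _ _ _ hx, B]
        exact isLUB_toReal_recession h (hA _ _ (mass_condFM π x))) hε
  refine ⟨q.1.1, q.1.2, q.2, ?_⟩
  rw [hG.2, (hglue _ _ (hgi q) (hBi q.1.1)).2, integral_add
    (integrable_rnDeriv_mul_integral_condKernel μ π q.1.1)
      (q.1.2.integrable_of_isFiniteMeasure μ)] at hq
  rw [integral_eq_integral_rnDeriv_add_integral_singularPart μ π q.1.1, realBarI]
  linarith

end Duality

section Smoothing

variable [CompactSpace X] [CompactSpace Y]

/-- The measure obtained from `π` by keeping the part of its first marginal which is absolutely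
continuous with respect to `μ`, and spreading the singular part with the kernel `K`. -/
def smoothing (μ : Measure X) (K : Kernel X X) (π : ProbabilityMeasure (X × Y)) :
    Measure (X × Y) :=
  (μ.withDensity ((π : Measure (X × Y)).fst.rnDeriv μ)) ⊗ₘ (π : Measure (X × Y)).condKernel +
    (K ×ₖ (π : Measure (X × Y)).condKernel) ∘ₘ (π : Measure (X × Y)).fst.singularPart μ

theorem isFiniteMeasure_withDensity_rnDeriv (μ : Measure X) (π : ProbabilityMeasure (X × Y)) :
    IsFiniteMeasure (μ.withDensity ((π : Measure (X × Y)).fst.rnDeriv μ)) :=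
  isFiniteMeasure_withDensity (Measure.lintegral_rnDeriv_lt_top _ _).ne

theorem snd_smoothing (μ : Measure X) [IsFiniteMeasure μ] (K : Kernel X X) [IsMarkovKernel K]
    (π : ProbabilityMeasure (X × Y)) :
    (smoothing μ K π).snd = (π : Measure (X × Y)).snd := by
  have := isFiniteMeasure_withDensity_rnDeriv μ π
  set κ := (π : Measure (X × Y)).condKernel
  have h1 : ((K ×ₖ κ) ∘ₘ (π : Measure (X × Y)).fst.singularPart μ).snd =
      κ ∘ₘ (π : Measure (X × Y)).fst.singularPart μ := by
    rw [Measure.snd, Measure.map_comp _ _ measurable_snd, ← Kernel.snd_eq, Kernel.snd_prod]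
  rw [smoothing, Measure.snd_add, Measure.snd_compProd, h1, ← Measure.comp_add, add_comm,
    Measure.singularPart_add_rnDeriv, ← Measure.snd_compProd,
    (π : Measure (X × Y)).disintegrate κ]

theorem fst_smoothing_absolutelyContinuous (μ : Measure X) [IsFiniteMeasure μ] (K : Kernel X X)
    [IsMarkovKernel K] (hK : ∀ y, K y ≪ μ) (π : ProbabilityMeasure (X × Y)) :
    (smoothing μ K π).fst ≪ μ := by
  have := isFiniteMeasure_withDensity_rnDeriv μ π
  set κ := (π : Measure (X × Y)).condKernel
  have h1 : ((K ×ₖ κ) ∘ₘ (π : Measure (X × Y)).fst.singularPart μ).fst =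
      K ∘ₘ (π : Measure (X × Y)).fst.singularPart μ := by
    rw [Measure.fst, Measure.map_comp _ _ measurable_fst, ← Kernel.fst_eq, Kernel.fst_prod]
  rw [smoothing, Measure.fst_add, Measure.fst_compProd, h1]
  refine (withDensity_absolutelyContinuous _ _).add_left ?_
  refine Measure.AbsolutelyContinuous.mk fun s hs hμs => ?_
  rw [Measure.bind_apply hs K.aemeasurable]
  simp [hK _ hμs]

theorem integral_smoothing (μ : Measure X) [IsFiniteMeasure μ] (K : Kernel X X)
    [IsMarkovKernel K] (π : ProbabilityMeasure (X × Y)) (f : C(X × Y, ℝ)) :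
    ∫ p, f p ∂smoothing μ K π =
      ∫ x, ((π : Measure (X × Y)).fst.rnDeriv μ x).toReal *
        ∫ y, f (x, y) ∂(π : Measure (X × Y)).condKernel x ∂μ +
      ∫ y, ∫ x, ∫ z, f (x, z) ∂(π : Measure (X × Y)).condKernel y ∂K y
        ∂(π : Measure (X × Y)).fst.singularPart μ := by
  have := isFiniteMeasure_withDensity_rnDeriv μ π
  have hf := fun ρ : Measure (X × Y) => fun _ : IsFiniteMeasure ρ =>
    f.integrable_of_isFiniteMeasure ρ
  rw [smoothing, integral_add_measure (hf _ inferInstance) (hf _ inferInstance),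
    Measure.integral_compProd (hf _ inferInstance),
    integral_withDensity_eq_integral_toReal_smul (Measure.measurable_rnDeriv _ _)
      (Measure.rnDeriv_lt_top _ _), Measure.comp_eq_comp_const_apply, Kernel.integral_comp, Kernel.const_apply]
  swap
  · rw [← Measure.comp_eq_comp_const_apply]
    exact hf _ inferInstance
  congr 1
  refine integral_congr_ae (ae_of_all _ fun y => ?_)
  simp only [Kernel.prod_apply]
  exact integral_prod _ (hf _ inferInstance)

theorem exists_tendsto_barI {c : X → FiniteMeasure Y → ℝ} {a : ℕ → C(X, ℝ)}
    {b : ℕ → C(X × Y, ℝ)} (h : ∀ (x : X) (m : FiniteMeasure Y),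
      IsLUB (range fun k => (∫ y, b k (x, y) ∂(m : Measure Y)) + a k x) (c x m))
    (hC : AssumpC c) {μ : Measure X} [IsProbabilityMeasure μ] {ν : Measure Y}
    (hν : IsProbabilityMeasure ν) {π : ProbabilityMeasure (X × Y)} (hπ : MemPiSupp μ ν π) :
    ∃ s : ℕ → ProbabilityMeasure (X × Y), (∀ n, MemPiAC μ ν (s n)) ∧
      Tendsto s atTop (𝓝 π) ∧
      Tendsto (fun n => Icmu c μ (s n)) atTop (𝓝 (barI c μ π)) := by
  obtain ⟨hcont, hrec, A, -, hA⟩ := hC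
  obtain ⟨K, hKm, hKμ, hKt⟩ := exists_kernel_tendsto_of_mem_msupport μ
  have hsnd : ∀ n, (smoothing μ (K n) π).snd = ν := fun n => by rw [snd_smoothing, hπ.2]
  have hprob : ∀ n, IsProbabilityMeasure (smoothing μ (K n) π) := fun n =>
    ⟨by rw [← Measure.snd_univ, hsnd n]; exact measure_univ⟩
  let s : ℕ → ProbabilityMeasure (X × Y) := fun n => ⟨smoothing μ (K n) π, hprob n⟩
  have hac : ∀ n, (s n : Measure (X × Y)).fst ≪ μ := fun n =>
    fst_smoothing_absolutelyContinuous μ (K n) (hKμ n) π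
  set σ := (π : Measure (X × Y)).fst.singularPart μ with hσ
  have hσ' : ∀ᵐ y ∂σ, ∀ g : X → ℝ, Continuous g →
      Tendsto (fun n => ∫ x, g x ∂K n y) atTop (𝓝 (g y)) := by
    have h1 : ∀ᵐ y ∂(π : Measure (X × Y)).fst, y ∈ msupport μ :=
      (prob_compl_eq_zero_iff (isClosed_msupport μ).measurableSet).2 hπ.1
    filter_upwards [(Measure.absolutelyContinuous_of_le
      (Measure.singularPart_le _ _)).ae_le h1] with y hy using hKt y hy
  have hJ : ∀ f : C(X × Y, ℝ), Tendsto (fun n => ∫ p, f p ∂(s n : Measure (X × Y))) atTop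
      (𝓝 (∫ p, f p ∂(π : Measure (X × Y)))) := by
    intro f
    rw [integral_eq_integral_rnDeriv_add_integral_singularPart μ π f]
    refine ((tendsto_integral_integral_kernel hσ' (measurable_integral_condKernel π f)
      (fun y => ?_) (C := ‖f‖) fun p => abs_integral_le_norm f p.2).const_add _).congr
        fun n => (integral_smoothing μ (K n) π f).symm
    refine continuous_of_dominated (μ := (π : Measure (X × Y)).condKernel y)
      (F := fun x z => f (x, z)) (bound := fun _ => ‖f‖) (fun x => ?_) (fun x => ?_)
      (integrable_const _) (ae_of_all _ fun z => by fun_prop)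
    · exact (f.continuous.comp (by fun_prop)).aestronglyMeasurable
    · exact ae_of_all _ fun z => f.norm_coe_le_norm _
  have hR : Tendsto (fun n => ∫ y, ∫ x, (recession c x (condFM π y)).toReal ∂K n y ∂σ) atTop
      (𝓝 (∫ y, (recession c y (condFM π y)).toReal ∂σ)) := by
    refine tendsto_integral_integral_kernel hσ' (measurable_toReal_recession h hA π)
      (fun y => ?_) (abs_toReal_recession_le h hA π)
    refine continuous_iff_continuousAt.2 fun x => ?_
    have hx := coe_toReal_recession h (hA x _ (mass_condFM π y))
    refine (EReal.tendsto_toReal ?_ ?_).comp (hrec (condFM π y)).continuousAt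
    · rw [← hx]; exact EReal.coe_ne_top _
    · rw [← hx]; exact EReal.coe_ne_bot _
  have hupper : ∀ n, realBarI c μ (s n) ≤ ∫ x, c x (fiber μ π x) ∂μ +
      ∫ y, ∫ x, (recession c x (condFM π y)).toReal ∂K n y ∂σ := by
    intro n
    refine le_of_forall_pos_sub_le fun ε hε => ?_
    obtain ⟨b', a', hm, hle⟩ := exists_isMinorant_realBarI_sub_le h hA (hcont 0) μ (s n) hε
    refine hle.trans ?_
    have h1 := hm.integral_add_integral_le h hA (hcont 0) μ π
    have h2 : ∫ y, ∫ x, ∫ z, b' (x, z) ∂(π : Measure (X × Y)).condKernel y ∂K n y ∂σ ≤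
        ∫ y, ∫ x, (recession c x (condFM π y)).toReal ∂K n y ∂σ := by
      have m1 := measurable_integral_condKernel π b'
      have m2 := measurable_toReal_recession h hA π
      refine integral_mono (Integrable.of_bound
        m1.stronglyMeasurable.integral_kernel_prod_right'.aestronglyMeasurable ‖b'‖
          (ae_of_all _ fun y => ?_)) (Integrable.of_bound
        m2.stronglyMeasurable.integral_kernel_prod_right'.aestronglyMeasurable (max ‖b 0‖ A)
          (ae_of_all _ fun y => ?_)) fun y => ?_
      · simpa using norm_integral_le_of_norm_le_const (μ := K n y)
          (f := fun x => ∫ z, b' (x, z) ∂(π : Measure (X × Y)).condKernel y)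
          (ae_of_all _ fun x => abs_integral_le_norm
            (ρ := (π : Measure (X × Y)).condKernel y) b' x)
      · simpa using norm_integral_le_of_norm_le_const (μ := K n y)
          (f := fun x => (recession c x (condFM π y)).toReal)
          (ae_of_all _ fun x => abs_toReal_recession_le h hA π (y, x))
      · refine integral_mono (Integrable.of_bound
          (m1.comp measurable_prodMk_left).aestronglyMeasurable ‖b'‖
            (ae_of_all _ fun x => abs_integral_le_norm b' x)) (Integrable.of_bound
          (m2.comp measurable_prodMk_left).aestronglyMeasurable (max ‖b 0‖ A)
            (ae_of_all _ fun x => abs_toReal_recession_le h hA π (y, x))) fun x => ?_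
        exact hm.integral_le_toReal_recession h hA π x y
    have h3 := integral_smoothing μ (K n) π b'
    change ∫ p, b' p ∂smoothing μ (K n) π + _ ≤ _
    rw [h3]
    linarith
  refine ⟨s, fun n => ⟨hac n, hsnd n⟩, ?_, ?_⟩
  · rw [ProbabilityMeasure.tendsto_iff_forall_integral_tendsto]
    exact fun f => hJ f.toContinuousMap
  · rw [barI_eq_realBarI h hA (hcont 0)]
    simp only [fun n => Icmu_eq_realBarI h hA (hcont 0) μ (s n) (hac n)]
    refine (continuous_coe_real_ereal.tendsto _).comp (tendsto_order.2 ⟨fun t ht => ?_,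
      fun t ht => ?_⟩)
    · obtain ⟨b', a', hm, hle⟩ := exists_isMinorant_realBarI_sub_le h hA (hcont 0) μ π
        (half_pos (sub_pos.2 ht))
      have hlt : t < ∫ p, b' p ∂(π : Measure (X × Y)) + ∫ x, a' x ∂μ := by linarith
      filter_upwards [((hJ b').add_const _).eventually (lt_mem_nhds hlt)] with n hn
      exact hn.trans_le (hm.integral_add_integral_le_realBarI h hA (hcont 0) μ (s n))
    · filter_upwards [(hR.const_add _).eventually (gt_mem_nhds ht)] with n hn
      exact (hupper n).trans_lt hn

end Smoothing

/-- Lemma `lem:recovery`: Assumptions (A) and (C) imply Assumption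
(Approx); more precisely, the approximating sequence can be taken to converge weakly
to `π`. -/
theorem assumpApprox_of_assumpA_assumpC
    [CompactSpace X] [CompactSpace Y]
    (c : X → FiniteMeasure Y → ℝ) (hc : IsCost c) (hA : AssumpA c) (hC : AssumpC c) :
    AssumpApprox c ∧
    ∀ (μ : Measure X) (ν : Measure Y), IsProbabilityMeasure μ → IsProbabilityMeasure ν →
      ∀ π : ProbabilityMeasure (X × Y), MemPiSupp μ ν π →
        ∃ s : ℕ → ProbabilityMeasure (X × Y), (∀ n, MemPiAC μ ν (s n)) ∧
          Tendsto s atTop (𝓝 π) ∧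
          Tendsto (fun n => Icmu c μ (s n)) atTop (𝓝 (barI c μ π)) := by
  obtain ⟨a, b, h⟩ := hA
  have key : ∀ (μ : Measure X) (ν : Measure Y), IsProbabilityMeasure μ →
      IsProbabilityMeasure ν → ∀ π : ProbabilityMeasure (X × Y), MemPiSupp μ ν π →
        ∃ s : ℕ → ProbabilityMeasure (X × Y), (∀ n, MemPiAC μ ν (s n)) ∧
          Tendsto s atTop (𝓝 π) ∧
          Tendsto (fun n => Icmu c μ (s n)) atTop (𝓝 (barI c μ π)) :=
    fun μ ν _ hν π hπ => exists_tendsto_barI h hC hν hπ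
  refine ⟨fun μ ν hμ hν π hπ => ?_, key⟩
  obtain ⟨s, hs, -, hs'⟩ := key μ ν hμ hν π hπ
  exact ⟨s, hs, hs'⟩

end UWOT
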